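/- Let H_d(η|ξ) = |ξ|/(π³·|η|²·|ξ−η|²) for nonzero ξ, η, ξ−η in ℝ³, and let H̃(θ,r) = (2/π²)·sin(θ)/(1 − 2r·cos(θ) + r²). For a measurable function m̃ : [0,∞) → [0,1], the following are equivalent: (a) for every λ ≥ 0, m̃(λ) = e^{−λ} + ∫₀^λ e^{−(λ−s)} ∫₀^π ∫₀^∞ m̃(r²s)·m̃((1 − 2r·cos(θ) + r²)·s)·H̃(θ,r) dr dθ ds; (b) for every nonzero ξ ∈ ℝ³ and every t ≥ 0, the function m(a,t) := m̃(a²·t) satisfies m(|ξ|,t) = e^{−|ξ|²t} + |ξ|²·∫₀^t e^{−|ξ|²(t−s)} ∫_{ℝ³} m(|η|,s)·m(|ξ−η|,s)·H_d(η|ξ) dη ds. -/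

import Mathlib

open MeasureTheory Real intervalIntegral

/-- The dilogarithmic branching density `H_d(η|ξ) = |ξ|/(π³ |η|² |ξ−η|²)` on `ℝ³`. -/
noncomputable def Hd (ξ η : EuclideanSpace ℝ (Fin 3)) : ℝ :=
  ‖ξ‖ / (π ^ 3 * ‖η‖ ^ 2 * ‖ξ - η‖ ^ 2)

/-- The angular density `H̃(θ,r) = (2/π²) sin θ/(1 − 2r cos θ + r²)`. -/
noncomputable def Htilde (θ r : ℝ) : ℝ :=
  (2 / π ^ 2) * Real.sin θ / (1 - 2 * r * Real.cos θ + r ^ 2)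

open Set ENNReal

theorem measurePreserving_euclideanSpace_fin_three :
    MeasurePreserving (fun η : EuclideanSpace ℝ (Fin 3) ↦ (η 0, η 1, η 2)) := by
  have h₁ := volume_preserving_finTwoArrow ℝ
  have h₂ := volume_preserving_piFinSuccAbove (fun _ : Fin 3 ↦ ℝ) 0
  have h₃ := EuclideanSpace.volume_preserving_symm_measurableEquiv_toLp (Fin 3)
  exact (((MeasurePreserving.id volume).prod h₁).comp h₂).comp h₃

theorem lintegral_radial_plane {h : ℝ → ℝ≥0∞} (hh : Measurable h) :
    ∫⁻ p : ℝ × ℝ, h (p.1 ^ 2 + p.2 ^ 2) =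
      ENNReal.ofReal (2 * π) * ∫⁻ ρ in Ioi (0 : ℝ), ENNReal.ofReal ρ * h (ρ ^ 2) := by
  rw [← lintegral_comp_polarCoord_symm, polarCoord_target, Measure.volume_eq_prod,
    ← Measure.prod_restrict, lintegral_prod _ (by
      simp only [polarCoord_symm_apply]; fun_prop)]
  have key (x y : ℝ) : (x * cos y) ^ 2 + (x * sin y) ^ 2 = x ^ 2 := by
    linear_combination x ^ 2 * sin_sq_add_cos_sq y
  simp only [polarCoord_symm_apply, smul_eq_mul, key, lintegral_const, Measure.restrict_apply_univ,
    Real.volume_Ioo]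
  rw [lintegral_mul_const _ (by fun_prop), mul_comm]
  ring_nf

theorem lintegral_halfPlane_polar {k : ℝ × ℝ → ℝ≥0∞} (hk : Measurable k) :
    ∫⁻ x : ℝ, ∫⁻ ρ in Ioi (0 : ℝ), k (x, ρ) =
      ∫⁻ θ in Ioo 0 π, ∫⁻ r in Ioi (0 : ℝ), ENNReal.ofReal r * k (r * cos θ, r * sin θ) := by
  have hS : MeasurableSet {p : ℝ × ℝ | 0 < p.2} := measurableSet_lt measurable_const measurable_snd
  have hK := hk.indicator hS
  calc
    _ = ∫⁻ p : ℝ × ℝ, indicator {p : ℝ × ℝ | 0 < p.2} k p := by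
      rw [Measure.volume_eq_prod, lintegral_prod _ hK.aemeasurable]
      refine lintegral_congr fun x ↦ ?_
      rw [← lintegral_indicator measurableSet_Ioi]
      rfl
    _ = ∫⁻ θ in Ioo (-π) π, ∫⁻ r in Ioi (0 : ℝ), ENNReal.ofReal r *
          indicator {p : ℝ × ℝ | 0 < p.2} k (r * cos θ, r * sin θ) := by
      rw [← lintegral_comp_polarCoord_symm, polarCoord_target, Measure.volume_eq_prod,
        ← Measure.prod_restrict, lintegral_prod_symm _ (by
          simp only [polarCoord_symm_apply]; fun_prop)]
      simp only [polarCoord_symm_apply, smul_eq_mul]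
    _ = ∫⁻ θ in Ioo (-π) π, indicator (Ioo 0 π) (fun θ ↦ ∫⁻ r in Ioi (0 : ℝ),
          ENNReal.ofReal r * k (r * cos θ, r * sin θ)) θ := by
      refine setLIntegral_congr_fun measurableSet_Ioo fun θ hθ ↦ ?_
      by_cases h : 0 < θ
      · rw [indicator_of_mem (show θ ∈ Ioo 0 π from ⟨h, hθ.2⟩)]
        refine setLIntegral_congr_fun measurableSet_Ioi fun r hr ↦ ?_
        rw [indicator_of_mem]
        exact mul_pos hr (sin_pos_of_pos_of_lt_pi h hθ.2)
      · rw [indicator_of_notMem (fun h' ↦ h h'.1)]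
        rw [setLIntegral_congr_fun (g := fun _ ↦ 0) measurableSet_Ioi, lintegral_zero]
        intro r hr
        beta_reduce
        rw [indicator_of_notMem, mul_zero]
        have := sin_nonpos_of_nonpos_of_neg_pi_le (not_lt.1 h) hθ.1.le
        exact not_lt.2 (mul_nonpos_of_nonneg_of_nonpos (le_of_lt hr) this)
    _ = _ := by
      rw [setLIntegral_indicator measurableSet_Ioo, inter_eq_left.2]
      exact Ioo_subset_Ioo_left (by linarith [pi_pos])

/-- Integration in spherical coordinates about the axis spanned by the unit vector `u`, for a
function of the distances to `0` and to `u`. -/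
theorem lintegral_spherical {g : ℝ × ℝ → ℝ≥0∞} (hg : Measurable g)
    {u : EuclideanSpace ℝ (Fin 3)} (hu : ‖u‖ = 1) :
    ∫⁻ η : EuclideanSpace ℝ (Fin 3), g (‖η‖ ^ 2, ‖u - η‖ ^ 2) =
      ∫⁻ θ in Ioo 0 π, ∫⁻ r in Ioi (0 : ℝ),
        ENNReal.ofReal (2 * π * r ^ 2 * sin θ) * g (r ^ 2, 1 - 2 * r * cos θ + r ^ 2) := by
  let e : EuclideanSpace ℝ (Fin 3) := EuclideanSpace.single 0 1
  have he : ‖u‖ = ‖e‖ := by simp [e, hu]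
  let R := (Submodule.span ℝ {u - e})ᗮ.reflection
  have hR : R u = e := Submodule.reflection_sub he
  let G : ℝ × ℝ × ℝ → ℝ≥0∞ := fun p ↦
    g (p.1 ^ 2 + (p.2.1 ^ 2 + p.2.2 ^ 2), (1 - p.1) ^ 2 + (p.2.1 ^ 2 + p.2.2 ^ 2))
  have hG : Measurable G := by fun_prop
  calc
    _ = ∫⁻ η : EuclideanSpace ℝ (Fin 3), G (R η 0, R η 1, R η 2) := by
      refine lintegral_congr fun η ↦ ?_
      have h₁ : ‖η‖ ^ 2 = ‖R η‖ ^ 2 := by rw [R.norm_map]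
      have h₂ : ‖u - η‖ ^ 2 = ‖e - R η‖ ^ 2 := by rw [← hR, ← map_sub, R.norm_map]
      rw [h₁, h₂, EuclideanSpace.real_norm_sq_eq, EuclideanSpace.real_norm_sq_eq]
      simp [G, e, Fin.sum_univ_three, add_assoc]
    _ = ∫⁻ p : ℝ × ℝ × ℝ, G p :=
      (measurePreserving_euclideanSpace_fin_three.comp R.measurePreserving).lintegral_comp hG
    _ = ∫⁻ x : ℝ, ∫⁻ ρ in Ioi (0 : ℝ), ENNReal.ofReal (2 * π) *
          (ENNReal.ofReal ρ * g (x ^ 2 + ρ ^ 2, (1 - x) ^ 2 + ρ ^ 2)) := by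
      rw [Measure.volume_eq_prod, lintegral_prod _ hG.aemeasurable]
      refine lintegral_congr fun x ↦ ?_
      rw [lintegral_radial_plane (h := fun q ↦ g (x ^ 2 + q, (1 - x) ^ 2 + q)) (by fun_prop),
        lintegral_const_mul _ (by fun_prop)]
    _ = _ := by
      rw [lintegral_halfPlane_polar (k := fun p ↦ ENNReal.ofReal (2 * π) *
          (ENNReal.ofReal p.2 * g (p.1 ^ 2 + p.2 ^ 2, (1 - p.1) ^ 2 + p.2 ^ 2))) (by fun_prop)]
      refine setLIntegral_congr_fun measurableSet_Ioo fun θ hθ ↦ ?_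
      refine setLIntegral_congr_fun measurableSet_Ioi fun r (hr : 0 < r) ↦ ?_
      have hs := sin_pos_of_pos_of_lt_pi hθ.1 hθ.2
      have h₁ : (r * cos θ) ^ 2 + (r * sin θ) ^ 2 = r ^ 2 := by
        linear_combination r ^ 2 * sin_sq_add_cos_sq θ
      have h₂ : (1 - r * cos θ) ^ 2 + (r * sin θ) ^ 2 = 1 - 2 * r * cos θ + r ^ 2 := by
        linear_combination r ^ 2 * sin_sq_add_cos_sq θ
      simp only [h₁, h₂, ← mul_assoc]
      rw [← ENNReal.ofReal_mul hr.le, ← ENNReal.ofReal_mul (by positivity)]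
      ring_nf

theorem integrable_Htilde {θ : ℝ} (hθ : sin θ ≠ 0) : Integrable (Htilde θ) := by
  have h := ((integrable_inv_one_add_sq.comp_div hθ).comp_sub_right (cos θ)).const_mul
    (2 / π ^ 2 / sin θ)
  refine h.congr (.of_forall fun r ↦ ?_)
  have h₁ : 1 - 2 * r * cos θ + r ^ 2 = sin θ ^ 2 * (1 + ((r - cos θ) / sin θ) ^ 2) := by
    field_simp
    linear_combination -sin_sq_add_cos_sq θ
  have h₂ : 1 + ((r - cos θ) / sin θ) ^ 2 ≠ 0 := by positivity
  simp only [Htilde, h₁]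
  field_simp

theorem Htilde_nonneg {θ : ℝ} (hθ : 0 ≤ sin θ) (r : ℝ) : 0 ≤ Htilde θ r := by
  have : 0 ≤ 1 - 2 * r * cos θ + r ^ 2 := by
    nlinarith [sq_nonneg (r - cos θ), sin_sq_add_cos_sq θ, sq_nonneg (sin θ)]
  unfold Htilde
  positivity

theorem Hd_nonneg (ξ η : EuclideanSpace ℝ (Fin 3)) : 0 ≤ Hd ξ η := by
  unfold Hd
  positivity

theorem integral_mul_Hd_of_norm_eq_one
    {mt : ℝ → ℝ} (hmeas : Measurable mt)
    (hrange : ∀ lam : ℝ, 0 ≤ lam → mt lam ∈ Set.Icc (0 : ℝ) 1)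
    {s : ℝ} (hs : 0 ≤ s) {u : EuclideanSpace ℝ (Fin 3)}
    (hu : ‖u‖ = 1) :
    ∫ η : EuclideanSpace ℝ (Fin 3), mt (‖η‖ ^ 2 * s) * mt (‖u - η‖ ^ 2 * s) * Hd u η =
      ∫ θ in (0 : ℝ)..π, ∫ r in Ioi (0 : ℝ),
        mt (r ^ 2 * s) * mt ((1 - 2 * r * cos θ + r ^ 2) * s) * Htilde θ r := by
  have hq (θ r : ℝ) : 0 ≤ 1 - 2 * r * cos θ + r ^ 2 := by
    nlinarith [sq_nonneg (r - cos θ), sin_sq_add_cos_sq θ, sq_nonneg (sin θ)]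
  have hm {x : ℝ} (hx : 0 ≤ x) : 0 ≤ mt (x * s) ∧ mt (x * s) ≤ 1 := hrange _ (mul_nonneg hx hs)
  have hsin {θ : ℝ} (hθ : θ ∈ Ioo 0 π) : 0 < sin θ := sin_pos_of_pos_of_lt_pi hθ.1 hθ.2
  have hnonneg {θ : ℝ} (hθ : θ ∈ Ioo 0 π) (r : ℝ) :
      0 ≤ mt (r ^ 2 * s) * mt ((1 - 2 * r * cos θ + r ^ 2) * s) * Htilde θ r :=
    mul_nonneg (mul_nonneg (hm (sq_nonneg r)).1 (hm (hq θ r)).1) (Htilde_nonneg (hsin hθ).le r)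
  have hmeas' : Measurable fun p : ℝ × ℝ ↦
      mt (p.2 ^ 2 * s) * mt ((1 - 2 * p.2 * cos p.1 + p.2 ^ 2) * s) * Htilde p.1 p.2 := by
    unfold Htilde
    fun_prop
  have hint {θ : ℝ} (hθ : θ ∈ Ioo 0 π) : IntegrableOn (fun r ↦
      mt (r ^ 2 * s) * mt ((1 - 2 * r * cos θ + r ^ 2) * s) * Htilde θ r) (Ioi 0) := by
    refine ((integrable_Htilde (hsin hθ).ne').mono'
      (hmeas'.comp (measurable_const.prodMk measurable_id)).aestronglyMeasurable
      (.of_forall fun r ↦ ?_)).integrableOn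
    simp only [Function.comp_apply, id, Real.norm_of_nonneg (hnonneg hθ r)]
    exact mul_le_of_le_one_left (Htilde_nonneg (hsin hθ).le r)
      (mul_le_one₀ (hm (sq_nonneg r)).2 (hm (hq θ r)).1 (hm (hq θ r)).2)
  rw [intervalIntegral.integral_of_le pi_pos.le, integral_Ioc_eq_integral_Ioo,
    integral_eq_lintegral_of_nonneg_ae, integral_eq_lintegral_of_nonneg_ae]
  rotate_left
  · exact (ae_restrict_iff' measurableSet_Ioo).2
      (.of_forall fun θ hθ ↦ integral_nonneg fun r ↦ hnonneg hθ r)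
  · exact hmeas'.stronglyMeasurable.integral_prod_right.aestronglyMeasurable
  · exact .of_forall fun η ↦ mul_nonneg
      (mul_nonneg (hm (sq_nonneg ‖η‖)).1 (hm (sq_nonneg ‖u - η‖)).1) (Hd_nonneg u η)
  · unfold Hd
    exact Measurable.aestronglyMeasurable (by fun_prop)
  congr 1
  trans ∫⁻ θ in Ioo 0 π, ∫⁻ r in Ioi (0 : ℝ), ENNReal.ofReal (2 * π * r ^ 2 * sin θ) *
      ENNReal.ofReal (mt (r ^ 2 * s) * mt ((1 - 2 * r * cos θ + r ^ 2) * s) *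
        (1 / (π ^ 3 * r ^ 2 * (1 - 2 * r * cos θ + r ^ 2))))
  · simp only [Hd, hu]
    exact lintegral_spherical (g := fun p ↦ ENNReal.ofReal
      (mt (p.1 * s) * mt (p.2 * s) * (1 / (π ^ 3 * p.1 * p.2)))) (by fun_prop) hu
  refine setLIntegral_congr_fun measurableSet_Ioo fun θ hθ ↦ ?_
  rw [ofReal_integral_eq_lintegral_ofReal (hint hθ) (.of_forall fun r ↦ hnonneg hθ r)]
  refine setLIntegral_congr_fun measurableSet_Ioi fun r (hr : 0 < r) ↦ ?_
  have := hsin hθ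
  rw [← ENNReal.ofReal_mul (by positivity), Htilde]
  congr 1
  field_simp

theorem integral_mul_Hd
    {mt : ℝ → ℝ} (hmeas : Measurable mt)
    (hrange : ∀ lam : ℝ, 0 ≤ lam → mt lam ∈ Set.Icc (0 : ℝ) 1)
    {s : ℝ} (hs : 0 ≤ s) {ξ : EuclideanSpace ℝ (Fin 3)} (hξ : ξ ≠ 0) :
    ∫ η : EuclideanSpace ℝ (Fin 3), mt (‖η‖ ^ 2 * s) * mt (‖ξ - η‖ ^ 2 * s) * Hd ξ η =
      ∫ θ in (0 : ℝ)..π, ∫ r in Ioi (0 : ℝ),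
        mt (r ^ 2 * (‖ξ‖ ^ 2 * s)) * mt ((1 - 2 * r * cos θ + r ^ 2) * (‖ξ‖ ^ 2 * s)) *
          Htilde θ r := by
  have ha : 0 < ‖ξ‖ := norm_pos_iff.2 hξ
  have hu : ‖‖ξ‖⁻¹ • ξ‖ = 1 := norm_smul_inv_norm hξ
  rw [← integral_mul_Hd_of_norm_eq_one hmeas hrange (by positivity) hu]
  have h := Measure.integral_comp_smul_of_nonneg volume (fun η : EuclideanSpace ℝ (Fin 3) ↦
    mt (‖η‖ ^ 2 * s) * mt (‖ξ - η‖ ^ 2 * s) * Hd ξ η) ‖ξ‖ (hR := ha.le)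
  rw [finrank_euclideanSpace_fin, eq_inv_smul_iff₀ (by positivity), smul_eq_mul] at h
  rw [← h, ← MeasureTheory.integral_const_mul]
  refine integral_congr_ae (.of_forall fun η ↦ ?_)
  have h₁ : ‖ξ - ‖ξ‖ • η‖ = ‖ξ‖ * ‖‖ξ‖⁻¹ • ξ - η‖ := by
    rw [← norm_smul_of_nonneg ha.le, smul_sub, smul_inv_smul₀ ha.ne']
  have h₂ : Hd (‖ξ‖⁻¹ • ξ) η = ‖ξ‖ ^ 3 * Hd ξ (‖ξ‖ • η) := by
    simp only [Hd, hu, h₁, norm_smul_of_nonneg ha.le]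
    field_simp
  simp only [h₁, h₂, norm_smul_of_nonneg ha.le]
  ring_nf

/-- For a measurable `m̃ : [0,∞) → [0,1]`, the similarity-variable integral equation
`m̃(λ) = e^{−λ} + ∫₀^λ e^{−(λ−s)} ∫₀^π ∫₀^∞ m̃(r²s) m̃((1 − 2r cos θ + r²)s) H̃(θ,r) dr dθ ds`
holds for all `λ ≥ 0` if and only if `m(a,t) := m̃(a² t)` satisfies, for every nonzero
`ξ ∈ ℝ³` and `t ≥ 0`,
`m(|ξ|,t) = e^{−|ξ|²t} + |ξ|² ∫₀^t e^{−|ξ|²(t−s)} ∫_{ℝ³} m(|η|,s) m(|ξ−η|,s) H_d(η|ξ) dη ds`. -/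
theorem selfSimilar_vs_NavierStokes_integral_equation
    (mt : ℝ → ℝ) (hmeas : Measurable mt)
    (hrange : ∀ lam : ℝ, 0 ≤ lam → mt lam ∈ Set.Icc (0 : ℝ) 1) :
    (∀ lam : ℝ, 0 ≤ lam →
      mt lam = Real.exp (-lam) +
        ∫ s in (0 : ℝ)..lam, Real.exp (-(lam - s)) *
          ∫ θ in (0 : ℝ)..π, ∫ r in Set.Ioi (0 : ℝ),
            mt (r ^ 2 * s) * mt ((1 - 2 * r * Real.cos θ + r ^ 2) * s) * Htilde θ r)
    ↔
    (∀ ξ : EuclideanSpace ℝ (Fin 3), ξ ≠ 0 → ∀ t : ℝ, 0 ≤ t →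
      mt (‖ξ‖ ^ 2 * t) = Real.exp (-(‖ξ‖ ^ 2 * t)) +
        ‖ξ‖ ^ 2 *
          ∫ s in (0 : ℝ)..t, Real.exp (-(‖ξ‖ ^ 2 * (t - s))) *
            ∫ η : EuclideanSpace ℝ (Fin 3),
              mt (‖η‖ ^ 2 * s) * mt (‖ξ - η‖ ^ 2 * s) * Hd ξ η) := by
  have key (ξ : EuclideanSpace ℝ (Fin 3)) (hξ : ξ ≠ 0) (t : ℝ) (ht : 0 ≤ t) :
      ‖ξ‖ ^ 2 * ∫ s in (0 : ℝ)..t, Real.exp (-(‖ξ‖ ^ 2 * (t - s))) *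
          ∫ η : EuclideanSpace ℝ (Fin 3), mt (‖η‖ ^ 2 * s) * mt (‖ξ - η‖ ^ 2 * s) * Hd ξ η =
        ∫ s in (0 : ℝ)..‖ξ‖ ^ 2 * t, Real.exp (-(‖ξ‖ ^ 2 * t - s)) *
          ∫ θ in (0 : ℝ)..π, ∫ r in Ioi (0 : ℝ),
            mt (r ^ 2 * s) * mt ((1 - 2 * r * cos θ + r ^ 2) * s) * Htilde θ r := by
    rw [← mul_zero (‖ξ‖ ^ 2), ← mul_integral_comp_mul_left]
    congr 1
    rw [mul_zero]
    refine intervalIntegral.integral_congr fun s hs ↦ ?_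
    rw [uIcc_of_le ht] at hs
    simp only [integral_mul_Hd hmeas hrange hs.1 hξ, mul_sub]
  constructor
  · intro h ξ hξ t ht
    rw [key ξ hξ t ht]
    exact h _ (by positivity)
  · intro h lam hlam
    have hu : ‖(EuclideanSpace.single 0 1 : EuclideanSpace ℝ (Fin 3))‖ = 1 := by simp
    have hne : (EuclideanSpace.single 0 1 : EuclideanSpace ℝ (Fin 3)) ≠ 0 :=
      norm_ne_zero_iff.1 (by simp)
    have := h _ hne lam hlam
    rwa [key _ hne lam hlam, hu, one_pow, one_mul] at this
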